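/- arXiv:1611.04185 — 3 statements merged into one kernel-verified Lean document; each statement's English description precedes it below -/
import Mathlib

section
/- Let S be a set and K : S × S → ℝ a symmetric kernel which is positive semidefinite, i.e., Σ_{i,j} c_i c_j K(s_i,s_j) ≥ 0 for all finite families s₁,…,s_n ∈ S and c₁,…,c_n ∈ ℝ. Then there exists a probability measure μ on the product measurable space ℝ^S = (S → ℝ) (with the σ-algebra generated by the coordinate maps π_s(x) = x(s)) such that for every n ∈ ℕ, every s₁,…,s_n ∈ S, and every c₁,…,c_n ∈ ℝ, the random variable x ↦ Σ_{i=1}^n c_i x(s_i) has, under μ, the centered Gaussian law on ℝ with variance Σ_{i,j} c_i c_j K(s_i,s_j). -/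
open MeasureTheory ProbabilityTheory Filter Topology
open scoped ENNReal

section KolmogorovExtension

variable {ι : Type*} {X : ι → Type*} [∀ i, TopologicalSpace (X i)]

/-- A sequence of cylinders with closed compact bases whose finite intersections are nonempty
has a nonempty intersection. -/
lemma nonempty_iInter_cylinder_of_isCompact {s : ℕ → Finset ι} {K : ∀ n, Set (∀ i : s n, X i)}
    (hKc : ∀ n, IsCompact (K n)) (hK : ∀ n, IsClosed (K n))
    (hne : ∀ n, (⋂ k ≤ n, cylinder (s k) (K k)).Nonempty) :
    (⋂ n, cylinder (s n) (K n)).Nonempty := by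
  classical
  choose x hx using hne
  have x_mem {k m : ℕ} (hkm : k ≤ m) : (s k).restrict (x m) ∈ K k :=
    (Set.mem_iInter₂.1 (hx m)) k hkm
  let y (m : ℕ) (i : ι) : X i := if ∃ n, i ∈ s n then x m i else x 0 i
  have restrict_y (k m : ℕ) : (s k).restrict (y m) = (s k).restrict (x m) := by
    ext i
    exact if_pos ⟨k, i.2⟩
  have compact_coord (i : ι) : ∃ Q : Set (X i), IsCompact Q ∧ ∀ m, y m i ∈ Q := by
    by_cases hi : ∃ n, i ∈ s n
    · obtain ⟨n, hn⟩ := hi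
      refine ⟨(fun z => z ⟨i, hn⟩) '' K n ∪ (fun m => y m i) '' Set.Iio n,
        ((hKc n).image (continuous_apply _)).union ((Set.finite_Iio n).image _).isCompact,
        fun m => ?_⟩
      rcases lt_or_ge m n with hmn | hnm
      · exact Or.inr ⟨m, hmn, rfl⟩
      · exact Or.inl ⟨_, restrict_y n m ▸ x_mem hnm, rfl⟩
    · exact ⟨{x 0 i}, isCompact_singleton, fun m => if_neg hi⟩
  choose Q hQ hyQ using compact_coord
  obtain ⟨z, -, hz⟩ := (isCompact_univ_pi hQ).exists_mapClusterPt (f := atTop) (u := y)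
    (tendsto_principal.2 (Eventually.of_forall fun m i _ => hyQ i m))
  refine ⟨z, Set.mem_iInter.2 fun n => ?_⟩
  have hclosed : IsClosed (cylinder (s n) (K n)) :=
    (hK n).preimage (Pi.continuous_domRestrict _)
  refine hclosed.mem_of_mapClusterPt hz ?_
  filter_upwards [eventually_ge_atTop n] with m hm
  simpa only [mem_cylinder, restrict_y] using x_mem hm

variable [∀ i, PolishSpace (X i)] [∀ i, MeasurableSpace (X i)] [∀ i, BorelSpace (X i)]
  {P : ∀ J : Finset ι, Measure (∀ j : J, X j)} [∀ J, IsFiniteMeasure (P J)]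

lemma projectiveFamilyContent_tendsto_zero (hP : IsProjectiveMeasureFamily P)
    {A : ℕ → Set (∀ i, X i)} (A_mem : ∀ n, A n ∈ measurableCylinders X)
    (A_anti : Antitone A) (A_inter : ⋂ n, A n = ∅) :
    Tendsto (fun n => projectiveFamilyContent hP (A n)) atTop (𝓝 0) := by
  choose s S hS A_eq using fun n => (mem_measurableCylinders _).1 (A_mem n)
  refine ENNReal.tendsto_nhds_zero.2 fun ε hε => ?_
  obtain ⟨δ, δ_pos, hδ⟩ := ENNReal.exists_pos_sum_of_countable' hε.ne' ℕ
  choose K hKS hKc hK hKδ using fun n =>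
    (hS n).exists_isCompact_isClosed_sdiff_lt (measure_ne_top (P (s n)) _) (δ_pos n).ne'
  have hC_empty : ¬ (⋂ n, cylinder (s n) (K n)).Nonempty := by
    rw [Set.not_nonempty_iff_eq_empty, ← Set.subset_empty_iff, ← A_inter]
    exact Set.iInter_mono fun n => A_eq n ▸ Set.preimage_mono (hKS n)
  obtain ⟨N, hN⟩ : ∃ N, ¬ (⋂ k ≤ N, cylinder (s k) (K k)).Nonempty := by
    by_contra! h
    exact hC_empty (nonempty_iInter_cylinder_of_isCompact hKc hK h)
  have hD (k : ℕ) : cylinder (s k) (S k \ K k) ∈ measurableCylinders X :=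
    cylinder_mem_measurableCylinders _ _ ((hS k).diff (hK k).measurableSet)
  have hD' : (⋃ k ∈ Finset.range (N + 1), cylinder (s k) (S k \ K k)) ∈ measurableCylinders X :=
    isSetRing_measurableCylinders.biUnion_mem _ fun k _ => hD k
  have hsub : A N ⊆ ⋃ k ∈ Finset.range (N + 1), cylinder (s k) (S k \ K k) := by
    intro x hx
    have hxN : x ∉ ⋂ k ≤ N, cylinder (s k) (K k) := fun h => hN ⟨x, h⟩
    simp only [Set.mem_iInter, not_forall] at hxN
    obtain ⟨k, hkN, hxk⟩ := hxN
    refine Set.mem_biUnion (Finset.mem_coe.2 (Finset.mem_range_succ_iff.2 hkN)) ⟨?_, hxk⟩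
    have hxA := A_anti hkN hx
    rwa [A_eq k] at hxA
  filter_upwards [eventually_ge_atTop N] with n hn
  calc projectiveFamilyContent hP (A n)
    _ ≤ projectiveFamilyContent hP (⋃ k ∈ Finset.range (N + 1), cylinder (s k) (S k \ K k)) :=
      projectiveFamilyContent_mono hP (A_mem n) hD' ((A_anti hn).trans hsub)
    _ ≤ ∑ k ∈ Finset.range (N + 1), projectiveFamilyContent hP (cylinder (s k) (S k \ K k)) :=
      addContent_biUnion_le isSetRing_measurableCylinders fun k _ => hD k
    _ ≤ ∑ k ∈ Finset.range (N + 1), δ k := by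
      refine Finset.sum_le_sum fun k _ => ?_
      rw [projectiveFamilyContent_cylinder hP ((hS k).diff (hK k).measurableSet)]
      exact (hKδ k).le
    _ ≤ ∑' k, δ k := ENNReal.sum_le_tsum _
    _ ≤ ε := hδ.le

/-- **Kolmogorov extension theorem**: a projective family of finite measures on finite products
of Polish spaces has a projective limit. -/
theorem exists_isProjectiveLimit (hP : IsProjectiveMeasureFamily P) :
    ∃ μ : Measure (∀ i, X i), IsProjectiveLimit μ P := by
  have hsub : (projectiveFamilyContent hP).IsSigmaSubadditive :=
    isSigmaSubadditive_of_addContent_iUnion_eq_tsum isSetRing_measurableCylinders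
      fun f hf hf_iUnion hf_disj =>
        addContent_iUnion_eq_sum_of_tendsto_zero isSetRing_measurableCylinders _
          (fun _ _ => projectiveFamilyContent_ne_top hP)
          (fun _ => projectiveFamilyContent_tendsto_zero hP) hf hf_iUnion hf_disj
  refine ⟨(projectiveFamilyContent hP).measure isSetSemiring_measurableCylinders
    generateFrom_measurableCylinders.ge hsub, fun I => ?_⟩
  ext t ht
  rw [Measure.map_apply (Finset.measurable_restrict I) ht, ← cylinder,
    AddContent.measure_eq _ _ generateFrom_measurableCylinders.symm _
      (cylinder_mem_measurableCylinders I t ht)]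
  exact projectiveFamilyContent_cylinder hP ht

end KolmogorovExtension

section GaussianFamily

variable {S : Type*} {K : S → S → ℝ}

lemma posSemidef_of_kernel (hsymm : ∀ s t : S, K s t = K t s)
    (hpos : ∀ (n : ℕ) (s : Fin n → S) (c : Fin n → ℝ),
      0 ≤ ∑ i, ∑ j, c i * c j * K (s i) (s j)) (I : Finset S) :
    (Matrix.of fun s t : I => K s t).PosSemidef := by
  refine .of_dotProduct_mulVec_nonneg (Matrix.IsHermitian.ext fun s t => hsymm t s) fun x => ?_
  have h := hpos I.card (fun i => I.equivFin.symm i) (fun i => x (I.equivFin.symm i))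
  rw [I.equivFin.symm.sum_comp
    (fun s => ∑ j, x s * x (I.equivFin.symm j) * K s (I.equivFin.symm j))] at h
  simp_rw [fun s : I => I.equivFin.symm.sum_comp (fun t => x s * x t * K s t)] at h
  refine h.trans_eq (Finset.sum_congr rfl fun s _ => ?_)
  simp only [Matrix.mulVec, dotProduct, Matrix.of_apply, Pi.star_apply, star_trivial,
    Finset.mul_sum]
  exact Finset.sum_congr rfl fun t _ => by ring

lemma isProjectiveMeasureFamily_multivariateGaussian [DecidableEq S]
    (hK : ∀ I : Finset S, (Matrix.of fun s t : I => K s t).PosSemidef) :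
    IsProjectiveMeasureFamily (α := fun _ : S => ℝ) fun I =>
      (multivariateGaussian 0 (Matrix.of fun s t : I => K s t)).map WithLp.ofLp := by
  intro I J hJI
  have h := (measurePreserving_restrict₂_multivariateGaussian (μ := 0) (hK I) hJI).map_eq
  have hcomp : Finset.restrict₂ (π := fun _ => ℝ) hJI ∘ WithLp.ofLp =
      WithLp.ofLp ∘ EuclideanSpace.restrict₂ (𝕜 := ℝ) hJI := by ext; simp
  have hrestrict : Measurable (Finset.restrict₂ (π := fun _ => ℝ) hJI) :=
    Finset.measurable_restrict₂ _
  beta_reduce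
  rw [Measure.map_map hrestrict (by fun_prop), hcomp,
    ← Measure.map_map (by fun_prop) (by fun_prop), h, map_zero]
  rfl

/-- The law of a linear combination, possibly with repetitions, of the coordinates of a centered
multivariate Gaussian vector. -/
lemma map_sum_multivariateGaussian {ι κ : Type*} [Fintype ι] [DecidableEq ι] [Fintype κ]
    {M : Matrix ι ι ℝ} (hM : M.PosSemidef) (s : κ → ι) (c : κ → ℝ) :
    (multivariateGaussian 0 M).map (fun x => ∑ i, c i * x (s i)) =
      gaussianReal 0 (∑ i, ∑ j, c i * c j * M (s i) (s j)).toNNReal := by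
  let L : StrongDual ℝ (EuclideanSpace ℝ ι) := ∑ i, c i • EuclideanSpace.proj (s i)
  have hL : (fun x : EuclideanSpace ℝ ι => ∑ i, c i * x (s i)) = L := by
    ext x; simp [L]
  have hmem (i : κ) : MemLp (fun x : EuclideanSpace ℝ ι => c i * x (s i)) 2
      (multivariateGaussian 0 M) :=
    (IsGaussian.memLp_dual _ (EuclideanSpace.proj (𝕜 := ℝ) (s i)) 2 (by simp)).const_mul (c i)
  rw [hL, IsGaussian.map_eq_gaussianReal, ContinuousLinearMap.integral_comp_id_comm
    IsGaussian.integrable_id, integral_id_multivariateGaussian, map_zero, ← hL,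
    ← covariance_self (by fun_prop), covariance_fun_sum_fun_sum hmem hmem]
  simp_rw [covariance_const_mul_left, covariance_const_mul_right,
    covariance_eval_multivariateGaussian hM, mul_assoc]

end GaussianFamily

/-- For every real symmetric positive semidefinite kernel `K` on a
set `S`, there is a probability measure `μ` on the product space `ℝ^S` (with the
σ-algebra generated by the coordinate maps) under which every finite linear
combination of coordinates `x ↦ Σ cᵢ x(sᵢ)` is a centered Gaussian with variance
`Σᵢⱼ cᵢ cⱼ K(sᵢ,sⱼ)`: the Gaussian process with covariance kernel `K`. -/
theorem exists_gaussian_process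
    {S : Type*} (K : S → S → ℝ)
    (hsymm : ∀ s t : S, K s t = K t s)
    (hpos : ∀ (n : ℕ) (s : Fin n → S) (c : Fin n → ℝ),
      0 ≤ ∑ i, ∑ j, c i * c j * K (s i) (s j)) :
    ∃ μ : Measure (S → ℝ), IsProbabilityMeasure μ ∧
      ∀ (n : ℕ) (s : Fin n → S) (c : Fin n → ℝ),
        μ.map (fun x : S → ℝ => ∑ i, c i * x (s i))
          = gaussianReal 0 (∑ i, ∑ j, c i * c j * K (s i) (s j)).toNNReal := by
  classical
  have hK := posSemidef_of_kernel hsymm hpos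
  have hP := isProjectiveMeasureFamily_multivariateGaussian hK
  have hprob (I : Finset S) : IsProbabilityMeasure
      ((multivariateGaussian 0 (Matrix.of fun s t : I => K s t)).map WithLp.ofLp) :=
    Measure.isProbabilityMeasure_map (by fun_prop)
  obtain ⟨μ, hμ⟩ := exists_isProjectiveLimit hP
  refine ⟨μ, hμ.isProbabilityMeasure, fun n s c => ?_⟩
  let I : Finset S := Finset.univ.image s
  let s' (i : Fin n) : I := ⟨s i, Finset.mem_image_of_mem s (Finset.mem_univ i)⟩
  have hcomp : (fun x : S → ℝ => ∑ i, c i * x (s i)) =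
      (fun y : I → ℝ => ∑ i, c i * y (s' i)) ∘ I.restrict := rfl
  have hrestrict : Measurable (I.restrict (π := fun _ => ℝ)) := Finset.measurable_restrict I
  rw [hcomp, ← Measure.map_map (by fun_prop) hrestrict, hμ I,
    Measure.map_map (by fun_prop) (by fun_prop)]
  exact map_sum_multivariateGaussian (hK I) s' c
end

section
/- Let μ be a Borel probability measure on ℝ such that the exponentials e_λ(x) := exp(2πiλx), λ ∈ Λ₄, form an orthonormal family in L²(μ), i.e., ∫_ℝ exp(2πi(λ − λ')x) dμ(x) = 1 if λ = λ' and = 0 if λ ≠ λ' (λ, λ' ∈ Λ₄). Define K^B(z,x) := ∏_{l=0}^∞ (1 + (conj(z)·exp(2πix))^{4^l}) for z in the open unit disk 𝔻 ⊂ ℂ and x ∈ ℝ. Then for all z, w ∈ 𝔻, ∫_ℝ K^B(z,x) · conj(K^B(w,x)) dμ(x) = ∏_{l=0}^∞ (1 + (conj(z)·w)^{4^l}). In other words, (ℝ, μ) with extension K^B is a measure boundary for the positive definite kernel K(z,w) = ∏_{l=0}^∞ (1 + (conj(z)w)^{4^l}) on 𝔻 × 𝔻. -/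
open MeasureTheory Complex Real

/-- `Λ₄`: the set of nonnegative integers whose base-4 expansion uses only the
digits 0 and 1, i.e. numbers of the form `Σ_{i ∈ F} 4^i` for finite `F ⊆ ℕ`. -/
def Lambda4 : Set ℕ := {n : ℕ | ∃ F : Finset ℕ, n = ∑ i ∈ F, 4 ^ i}

lemma summable_norm_pow_sum_four_pow {t : ℂ} (ht : ‖t‖ < 1) :
    Summable fun F : Finset ℕ => ‖t ^ (∑ i ∈ F, 4 ^ i)‖ := by
  have hg : Summable fun n : ℕ => ‖t‖ ^ n := summable_geometric_of_lt_one (norm_nonneg t) ht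
  have h := hg.comp_injective (Finset.geomSum_injective (n := 4) (by norm_num))
  simpa [Function.comp_def, norm_pow] using h

/-- `∏ (1 + t^(4^l))` expands as the sum of `t^λ` over `λ = ∑ i ∈ F, 4^i`. -/
lemma tprod_one_add_pow_four_pow {t : ℂ} (ht : ‖t‖ < 1) :
    ∏' l : ℕ, (1 + t ^ (4 ^ l)) = ∑' F : Finset ℕ, t ^ (∑ i ∈ F, 4 ^ i) := by
  have h : Summable fun F : Finset ℕ => ∏ i ∈ F, t ^ (4 ^ i) := by
    simpa only [Finset.prod_pow_eq_pow_sum] using (summable_norm_pow_sum_four_pow ht).of_norm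
  rw [tprod_one_add h]
  simp only [Finset.prod_pow_eq_pow_sum]

lemma norm_mul_exp_two_pi_I (a : ℂ) (x : ℝ) : ‖a * Complex.exp (2 * π * I * x)‖ = ‖a‖ := by
  have h : (2 * π * I * x : ℂ) = ((2 * π * x : ℝ) : ℂ) * I := by push_cast; ring
  rw [norm_mul, h, Complex.norm_exp_ofReal_mul_I, mul_one]

lemma mul_exp_pow_mul_conj_pow (z w : ℂ) (x : ℝ) (m n : ℕ) :
    ((starRingEnd ℂ) z * Complex.exp (2 * π * I * x)) ^ m *
        (starRingEnd ℂ) (((starRingEnd ℂ) w * Complex.exp (2 * π * I * x)) ^ n) =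
      (starRingEnd ℂ) z ^ m * w ^ n *
        Complex.exp (2 * π * I * ((m : ℂ) - (n : ℂ)) * x) := by
  have hconj : (starRingEnd ℂ) (Complex.exp (2 * π * I * x)) = Complex.exp (-(2 * π * I * x)) := by
    rw [← Complex.exp_conj]
    simp [map_ofNat (starRingEnd ℂ) 2]
  have hexp : Complex.exp (2 * π * I * ((m : ℂ) - (n : ℂ)) * x) =
      Complex.exp (2 * π * I * x) ^ m * Complex.exp (-(2 * π * I * x)) ^ n := by
    rw [← Complex.exp_nat_mul, ← Complex.exp_nat_mul, ← Complex.exp_add]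
    congr 1
    ring
  rw [hexp, map_pow, map_mul, hconj, Complex.conj_conj, mul_pow, mul_pow]
  ring

/-- If the exponentials `e_λ(x) = exp(2πiλx)`, `λ ∈ Λ₄`, are
orthonormal in `L²(μ)` (as holds for the 1/4-Cantor measure), then
`K^B(z,x) = ∏_{l≥0} (1 + (conj z · e^{2πix})^{4^l})` realizes `(ℝ, μ)` as a
measure boundary for the kernel `K(z,w) = ∏_{l≥0} (1 + (conj z · w)^{4^l})`
on `𝔻 × 𝔻`. -/
theorem cantor_measure_boundary_factorization
    (μ : Measure ℝ) [IsProbabilityMeasure μ]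
    (horth : ∀ lam ∈ Lambda4, ∀ lam' ∈ Lambda4,
      ∫ x : ℝ, Complex.exp (2 * π * I * ((lam : ℂ) - (lam' : ℂ)) * x) ∂μ
        = if lam = lam' then 1 else 0) :
    ∀ z w : ℂ, ‖z‖ < 1 → ‖w‖ < 1 →
      ∫ x : ℝ,
          (∏' l : ℕ, (1 + ((starRingEnd ℂ) z * Complex.exp (2 * π * I * x)) ^ (4 ^ l))) *
            (starRingEnd ℂ)
              (∏' l : ℕ, (1 + ((starRingEnd ℂ) w * Complex.exp (2 * π * I * x)) ^ (4 ^ l))) ∂μ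
        = ∏' l : ℕ, (1 + ((starRingEnd ℂ) z * w) ^ (4 ^ l)) := by
  intro z w hz hw
  have hz' : ‖(starRingEnd ℂ) z‖ < 1 := by rwa [RCLike.norm_conj]
  have hw' : ‖(starRingEnd ℂ) w‖ < 1 := by rwa [RCLike.norm_conj]
  have hzw : ‖(starRingEnd ℂ) z * w‖ < 1 := by
    rw [norm_mul]
    exact mul_lt_one_of_nonneg_of_lt_one_left (norm_nonneg _) hz' hw.le
  let s : Finset ℕ → ℕ := fun F => ∑ i ∈ F, 4 ^ i
  have hs : Function.Injective s := Finset.geomSum_injective (by norm_num)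
  let f : Finset ℕ × Finset ℕ → ℝ → ℂ := fun p x =>
    (starRingEnd ℂ) z ^ s p.1 * w ^ s p.2 *
      Complex.exp (2 * π * I * ((s p.1 : ℂ) - (s p.2 : ℂ)) * x)
  have hf_norm (p : Finset ℕ × Finset ℕ) (x : ℝ) :
      ‖f p x‖ = ‖(starRingEnd ℂ) z ^ s p.1‖ * ‖w ^ s p.2‖ := by
    have h : (2 * π * I * ((s p.1 : ℂ) - (s p.2 : ℂ)) * x : ℂ) =
        ((2 * π * ((s p.1 : ℝ) - (s p.2 : ℝ)) * x : ℝ) : ℂ) * I := by push_cast; ring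
    simp only [f]
    rw [norm_mul, norm_mul, h, Complex.norm_exp_ofReal_mul_I, mul_one]
  have hf_cont (p : Finset ℕ × Finset ℕ) : Continuous (f p) := by fun_prop
  have hf_int (p : Finset ℕ × Finset ℕ) : Integrable (f p) μ :=
    .of_bound (hf_cont p).aestronglyMeasurable _ (.of_forall fun x => (hf_norm p x).le)
  have hf_sum : Summable fun p => ∫ x, ‖f p x‖ ∂μ := by
    simpa [hf_norm] using (summable_norm_pow_sum_four_pow hz').mul_of_nonneg
      (summable_norm_pow_sum_four_pow hw) (fun _ => norm_nonneg _) (fun _ => norm_nonneg _)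
  have hf_integral (p : Finset ℕ × Finset ℕ) :
      ∫ x, f p x ∂μ = if p.1 = p.2 then ((starRingEnd ℂ) z * w) ^ s p.1 else 0 := by
    simp only [f]
    rw [integral_const_mul, horth _ ⟨p.1, rfl⟩ _ ⟨p.2, rfl⟩]
    by_cases h : p.1 = p.2
    · simp [h, mul_pow]
    · rw [if_neg (hs.ne h), if_neg h, mul_zero]
  have hexpand (x : ℝ) :
      (∏' l : ℕ, (1 + ((starRingEnd ℂ) z * Complex.exp (2 * π * I * x)) ^ (4 ^ l))) *
          (starRingEnd ℂ)
            (∏' l : ℕ, (1 + ((starRingEnd ℂ) w * Complex.exp (2 * π * I * x)) ^ (4 ^ l))) =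
        ∑' p, f p x := by
    have hzx := (norm_mul_exp_two_pi_I ((starRingEnd ℂ) z) x).trans_lt hz'
    have hwx := (norm_mul_exp_two_pi_I ((starRingEnd ℂ) w) x).trans_lt hw'
    rw [tprod_one_add_pow_four_pow hzx, tprod_one_add_pow_four_pow hwx, Complex.conj_tsum,
      tsum_mul_tsum_of_summable_norm (summable_norm_pow_sum_four_pow hzx)
        (by simpa only [RCLike.norm_conj] using summable_norm_pow_sum_four_pow hwx)]
    exact tsum_congr fun p => mul_exp_pow_mul_conj_pow z w x (s p.1) (s p.2)
  simp_rw [hexpand]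
  rw [← integral_tsum_of_summable_integral_norm hf_int hf_sum, tprod_one_add_pow_four_pow hzw]
  simp_rw [hf_integral]
  have hdiag : Function.Injective fun F : Finset ℕ => (F, F) := fun _ _ h => congrArg Prod.fst h
  rw [← hdiag.tsum_eq]
  · simp [s]
  · rintro ⟨F, G⟩ h
    by_cases hFG : F = G
    · exact ⟨F, by simp [hFG]⟩
    · simp [hFG] at h
end

section
/- Let μ be a Borel probability measure on ℝ such that the exponentials e_λ(x) := exp(2πiλx), λ ∈ Λ₄, form an orthonormal BASIS of L²(μ) (orthonormal with dense linear span). Define K^B(z,x) := ∏_{l=0}^∞ (1 + (conj(z)·exp(2πix))^{4^l}) for z ∈ 𝔻, x ∈ ℝ. Then the closed linear span in L²(μ) of the family {K^B(z,·) : z ∈ 𝔻} is all of L²(μ). Equivalently, the canonical isometry W_B from the RKHS of K(z,w) = ∏_{l=0}^∞ (1 + (conj(z)w)^{4^l}) into L²(μ) is surjective. -/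
open MeasureTheory Complex Real

open scoped BoundedContinuousFunction

/-- If the sums of a vector-valued power series on the unit disk lie in a closed subspace, then
so do its coefficients. -/
theorem Submodule.mem_of_forall_hasSum_pow_smul {E : Type*} [NormedAddCommGroup E]
    [NormedSpace ℂ E] (S : Submodule ℂ E) (hS : IsClosed (S : Set E)) (a : ℕ → E)
    (h : ∀ w : ℂ, ‖w‖ < 1 → ∃ s ∈ S, HasSum (fun n => w ^ n • a n) s) (n : ℕ) : a n ∈ S := by
  have := hS
  let p : FormalMultilinearSeries ℂ ℂ (E ⧸ S) := fun n =>
    ContinuousMultilinearMap.mkPiRing ℂ (Fin n) (S.mkQ (a n))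
  have hp : HasFPowerSeriesAt 0 p (0 : ℂ) := by
    rw [hasFPowerSeriesAt_iff]
    filter_upwards [Metric.ball_mem_nhds (0 : ℂ) one_pos] with w hw
    obtain ⟨s, hs, hsum⟩ := h w (by simpa using hw)
    have hq := hsum.map S.mkQ S.continuous_mkQ
    rw [S.mkQ_apply, (Submodule.Quotient.mk_eq_zero S).2 hs] at hq
    simpa [p, FormalMultilinearSeries.coeff, Function.comp_def] using hq
  have hcoeff : p.coeff n = 0 := by simp [hp.eq_zero, FormalMultilinearSeries.coeff]
  simpa [p, FormalMultilinearSeries.coeff] using hcoeff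

/-- The expansion `∏ (1 + t ^ 4 ^ l) = ∑_{λ ∈ Λ₄} t ^ λ` for `‖t‖ < 1`. -/
theorem hasSum_indicator_Lambda4_pow {t : ℂ} (ht : ‖t‖ < 1) :
    HasSum (Lambda4.indicator fun n => t ^ n) (∏' l : ℕ, (1 + t ^ 4 ^ l)) := by
  have hinj := Finset.geomSum_injective (n := 4) (by norm_num)
  have hgeom : Summable fun n => ‖t ^ n‖ := by
    simpa using summable_geometric_of_lt_one (norm_nonneg t) ht
  have hsum : Summable fun F : Finset ℕ => ∏ i ∈ F, t ^ 4 ^ i := by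
    simpa only [Finset.prod_pow_eq_pow_sum, Function.comp_def] using
      hgeom.of_norm.comp_injective hinj
  rw [tprod_one_add hsum, ← hinj.hasSum_iff]
  · convert hsum.hasSum using 2 with F
    rw [Function.comp_apply, Set.indicator_of_mem (show _ ∈ Lambda4 from ⟨F, rfl⟩), Finset.prod_pow_eq_pow_sum]
  · rintro n hn
    refine Set.indicator_of_notMem ?_ _
    rintro ⟨F, rfl⟩
    exact hn ⟨F, rfl⟩

/-- The fundamental character `x ↦ exp (2πix)` as a bounded continuous function. -/
noncomputable def boundedExp : ℝ →ᵇ ℂ :=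
  BoundedContinuousFunction.ofNormedAddCommGroup (fun x : ℝ => Complex.exp (2 * π * I * x))
    (by fun_prop) 1 fun x => by
      rw [show (2 * π * I * x : ℂ) = (2 * π * x : ℝ) * I by push_cast; ring,
        Complex.norm_exp_ofReal_mul_I]

theorem boundedExp_apply (x : ℝ) : boundedExp x = Complex.exp (2 * π * I * x) := rfl

theorem norm_boundedExp_le : ‖boundedExp‖ ≤ 1 :=
  BoundedContinuousFunction.norm_ofNormedAddCommGroup_le _ zero_le_one _

theorem boundedExp_pow_apply (n : ℕ) (x : ℝ) :
    (boundedExp ^ n) x = Complex.exp (2 * π * I * n * x) := by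
  rw [BoundedContinuousFunction.pow_apply, boundedExp_apply, ← Complex.exp_nat_mul]
  ring_nf

/-- The kernel `∏ (1 + (w e^{2πi·})^{4^l})` is the uniform sum of its power series in `w`. -/
theorem exists_hasSum_indicator_Lambda4_boundedExp {w : ℂ} (hw : ‖w‖ < 1) :
    ∃ k : ℝ →ᵇ ℂ, (∀ x : ℝ, k x = ∏' l : ℕ, (1 + (w * Complex.exp (2 * π * I * x)) ^ 4 ^ l)) ∧
      HasSum (fun n => w ^ n • Lambda4.indicator (fun n => boundedExp ^ n) n) k := by
  have hbound : ∀ n, ‖w ^ n • Lambda4.indicator (fun n => boundedExp ^ n) n‖ ≤ ‖w‖ ^ n := by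
    intro n
    rw [norm_smul, norm_pow]
    refine mul_le_of_le_one_right (by positivity) ((norm_indicator_le_norm_self _ _).trans ?_)
    exact (norm_pow_le _ _).trans (pow_le_one₀ (norm_nonneg _) norm_boundedExp_le)
  obtain ⟨k, hk⟩ : Summable fun n => w ^ n • Lambda4.indicator (fun n => boundedExp ^ n) n :=
    .of_norm_bounded (summable_geometric_of_lt_one (norm_nonneg w) hw) hbound
  refine ⟨k, fun x => ?_, hk⟩
  have hx : ‖w * Complex.exp (2 * π * I * x)‖ < 1 := by
    rw [norm_mul, ← boundedExp_apply]
    exact (mul_le_of_le_one_right (norm_nonneg w)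
      ((boundedExp.norm_coe_le_norm x).trans norm_boundedExp_le)).trans_lt hw
  refine HasSum.unique ?_ (hasSum_indicator_Lambda4_pow hx)
  have hkx : HasSum _ (k x) := (BoundedContinuousFunction.evalCLM ℂ x).hasSum hk
  convert hkx using 2 with n
  by_cases hn : n ∈ Lambda4 <;> simp [hn, mul_pow, boundedExp_apply]

/-- If the exponentials `e_λ`, `λ ∈ Λ₄`, form an orthonormal
basis of `L²(μ)` (orthonormal with dense span, as for the 1/4-Cantor measure),
then the boundary kernels `K^B(z,·) = ∏_{l≥0}(1 + (conj z · e^{2πi·})^{4^l})`,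
`z ∈ 𝔻`, have dense linear span in `L²(μ)`: the canonical isometry `W_B` from
the RKHS of `K(z,w) = ∏_{l≥0}(1 + (conj z w)^{4^l})` into `L²(μ)` is onto. -/
theorem cantor_boundary_isometry_surjective
    (μ : Measure ℝ) [IsProbabilityMeasure μ]
    (horth : ∀ lam ∈ Lambda4, ∀ lam' ∈ Lambda4,
      ∫ x : ℝ, Complex.exp (2 * π * I * ((lam : ℂ) - (lam' : ℂ)) * x) ∂μ
        = if lam = lam' then 1 else 0)
    (hdense : (Submodule.span ℂ
        {g : Lp ℂ 2 μ | ∃ lam ∈ Lambda4,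
          (g : ℝ → ℂ) =ᵐ[μ] fun x : ℝ =>
            Complex.exp (2 * π * I * (lam : ℂ) * x)}).topologicalClosure = ⊤) :
    (Submodule.span ℂ
        {g : Lp ℂ 2 μ | ∃ z : ℂ, ‖z‖ < 1 ∧
          (g : ℝ → ℂ) =ᵐ[μ] fun x : ℝ =>
            ∏' l : ℕ, (1 + ((starRingEnd ℂ) z *
              Complex.exp (2 * π * I * x)) ^ (4 ^ l))}).topologicalClosure = ⊤ := by
  set S := (Submodule.span ℂ
        {g : Lp ℂ 2 μ | ∃ z : ℂ, ‖z‖ < 1 ∧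
          (g : ℝ → ℂ) =ᵐ[μ] fun x : ℝ =>
            ∏' l : ℕ, (1 + ((starRingEnd ℂ) z *
              Complex.exp (2 * π * I * x)) ^ (4 ^ l))}).topologicalClosure
  let T := BoundedContinuousFunction.toLp (α := ℝ) (E := ℂ) 2 μ ℂ
  have hmem := S.mem_of_forall_hasSum_pow_smul (Submodule.isClosed_topologicalClosure _)
    (fun n => T (Lambda4.indicator (fun n => boundedExp ^ n) n)) fun w hw => by
      obtain ⟨k, hk, hsum⟩ := exists_hasSum_indicator_Lambda4_boundedExp hw
      refine ⟨T k, Submodule.le_topologicalClosure _ (Submodule.subset_span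
        ⟨(starRingEnd ℂ) w, by simpa using hw, ?_⟩), by simpa using T.hasSum hsum⟩
      filter_upwards [BoundedContinuousFunction.coeFn_toLp (p := 2) μ ℂ k] with x hx
      rw [hx, hk, Complex.conj_conj]
  rw [eq_top_iff, ← hdense]
  refine Submodule.topologicalClosure_minimal _ (Submodule.span_le.2 ?_)
    (Submodule.isClosed_topologicalClosure _)
  rintro g ⟨n, hn, hg⟩
  have hgT : g = T (boundedExp ^ n) := by
    refine Lp.ext (hg.trans ?_)
    filter_upwards [BoundedContinuousFunction.coeFn_toLp (p := 2) μ ℂ (boundedExp ^ n)] with x hx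
    rw [hx, boundedExp_pow_apply]
  simpa [hgT, hn] using hmem n
end
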